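/- Let A be an m × n matrix with entries in {0,1} and M = AᵀA with M ≠ 0. Then herdisc(A) ≥ (tr M)² / (8e · tr(M²) · min{m,n}) · √(tr(M)/max{m,n}). -/

import Mathlib

open Matrix

theorem cb {κ ν : Type*} [Fintype κ] [DecidableEq κ] [Fintype ν] [DecidableEq ν]
    (P : Matrix κ ν ℝ) (Q : Matrix ν κ ℝ) :
    ((Fintype.card κ).factorial : ℝ) * (P * Q).det =
      ∑ p : κ → ν, (P.submatrix id p).det * (Q.submatrix p id).det := by
  have h1 : (P * Q).det = ∑ p : κ → ν, (P.submatrix id p).det * ∏ i, Q (p i) i := by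
    simp only [det_apply', mul_apply, Finset.prod_univ_sum, Finset.mul_sum, Fintype.piFinset_univ,
      Finset.sum_mul]
    rw [Finset.sum_comm]
    simp [Finset.prod_mul_distrib, mul_assoc]
  have h2 : ∀ τ : Equiv.Perm κ, (P * Q).det =
      ∑ p : κ → ν, (P.submatrix id p).det * (((Equiv.Perm.sign τ : ℤ) : ℝ) * ∏ i, Q (p (τ i)) i) := by
    intro τ
    rw [h1]
    rw [← Equiv.sum_comp (Equiv.arrowCongr τ.symm (Equiv.refl ν))]
    refine Finset.sum_congr rfl fun p _ => ?_
    have := det_permute' τ (P.submatrix id p)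
    rw [submatrix_submatrix] at this
    simp only [Function.comp_id] at this
    have e : (Equiv.arrowCongr τ.symm (Equiv.refl ν)) p = p ∘ τ := by
      ext; simp
    rw [e, this]
    simp only [Function.comp_apply]
    ring
  have h3 : ∑ τ : Equiv.Perm κ, (P * Q).det = ((Fintype.card κ).factorial : ℝ) * (P * Q).det := by
    simp [Finset.card_univ, Fintype.card_perm]
  rw [← h3, Finset.sum_congr rfl fun τ _ => h2 τ, Finset.sum_comm]
  refine Finset.sum_congr rfl fun p _ => ?_
  rw [← Finset.mul_sum, det_apply' (Q.submatrix p id)]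
  simp

theorem round_dyadic {κ : Type*} [Fintype κ] [DecidableEq κ] (B : Matrix κ κ ℝ) (D : ℝ)
    (h : ∀ Y : Finset κ, ∃ x : κ → ℝ, (∀ j, x j = 1 ∨ x j = -1) ∧
      ∀ i, |∑ j ∈ Y, B i j * x j| ≤ D) (l : ℕ) :
    ∀ z : κ → ℕ, (∀ j, z j ≤ 2 ^ l) → ∃ b : κ → Bool,
      ∀ i, |∑ j, B i j * ((z j : ℝ) / 2 ^ l - (if b j then 1 else 0))| ≤ (1 - 1 / 2 ^ l) * D := by
  induction l with
  | zero =>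
    intro z hz
    refine ⟨fun j => decide (z j = 1), fun i => ?_⟩
    have : ∀ j, ((z j : ℝ) / 2 ^ 0 - (if decide (z j = 1) = true then 1 else 0)) = 0 := by
      intro j
      have := hz j
      have h' : z j = 0 ∨ z j = 1 := by simp at this; omega
      rcases h' with h' | h' <;> simp [h']
    simp only [this]
    simp
  | succ l ih =>
    intro z hz
    obtain ⟨c, hc, hd⟩ := h (Finset.univ.filter fun j => z j % 2 = 1)
    obtain ⟨b, hb⟩ := ih (fun j => if z j % 2 = 1 ∧ c j = 1 then (z j + 1) / 2 else z j / 2) (by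
      intro j
      have := hz j
      rw [pow_succ] at this
      split_ifs <;> omega)
    refine ⟨b, fun i => ?_⟩
    have key : ∑ j, B i j * ((z j : ℝ) / 2 ^ (l+1) - (if b j then 1 else 0)) =
        ∑ j, B i j * (((if z j % 2 = 1 ∧ c j = 1 then (z j + 1) / 2 else z j / 2 : ℕ) : ℝ) / 2 ^ l
          - (if b j then 1 else 0)) -
        (1 / 2 ^ (l+1)) * ∑ j ∈ Finset.univ.filter (fun j => z j % 2 = 1), B i j * c j := by
      rw [Finset.sum_filter, Finset.mul_sum, ← Finset.sum_sub_distrib]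
      refine Finset.sum_congr rfl fun j _ => ?_
      rcases Nat.mod_two_eq_zero_or_one (z j) with hz0 | hz1
      · have : (z j : ℝ) = 2 * ((z j / 2 : ℕ) : ℝ) := by
          have : z j = 2 * (z j / 2) := by omega
          exact_mod_cast this
        simp only [hz0]
        simp only [zero_ne_one, false_and, if_false]
        rw [this, pow_succ]; field_simp; simp
      · rcases hc j with h1 | h1
        · have : (z j : ℝ) = 2 * (((z j + 1) / 2 : ℕ) : ℝ) - 1 := by
            have : z j + 1 = 2 * ((z j + 1) / 2) := by omega
            have h2 : (z j : ℝ) + 1 = 2 * (((z j + 1) / 2 : ℕ) : ℝ) := by exact_mod_cast this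
            linarith
          simp only [hz1, h1, and_self, if_true]
          rw [this, pow_succ]; field_simp; ring
        · have : (z j : ℝ) = 2 * (((z j) / 2 : ℕ) : ℝ) + 1 := by
            have : z j = 2 * ((z j) / 2) + 1 := by omega
            exact_mod_cast this
          have hne : ¬ ((-1 : ℝ) = 1) := by norm_num
          simp only [hz1, h1, hne, and_false, if_true, if_false]
          rw [this, pow_succ]; field_simp; ring
    rw [key]
    refine (abs_sub _ _).trans ?_
    rw [abs_mul, abs_of_nonneg (by positivity : (0:ℝ) ≤ 1 / 2 ^ (l+1))]
    have h1 := hb i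
    have h2 := mul_le_mul_of_nonneg_left (hd i) (by positivity : (0:ℝ) ≤ 1 / 2 ^ (l+1))
    refine (add_le_add h1 h2).trans (le_of_eq ?_)
    rw [pow_succ]; field_simp; ring

theorem round_real {κ : Type*} [Fintype κ] [DecidableEq κ] (B : Matrix κ κ ℝ) (D D' : ℝ)
    (hD : 0 ≤ D) (hDD : D < D')
    (h : ∀ Y : Finset κ, ∃ x : κ → ℝ, (∀ j, x j = 1 ∨ x j = -1) ∧
      ∀ i, |∑ j ∈ Y, B i j * x j| ≤ D) (w : κ → ℝ) (hw : ∀ j, 0 ≤ w j ∧ w j < 1) :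
    ∃ b : κ → Bool, ∀ i, |∑ j, B i j * (w j - (if b j then 1 else 0))| ≤ D' := by
  set C : ℝ := ∑ i, ∑ j, |B i j| with hC
  have hC0 : 0 ≤ C := by positivity
  obtain ⟨l, hl⟩ := exists_pow_lt_of_lt_one (show 0 < (D' - D) / (C + 1) by
    apply div_pos <;> linarith) (show (1/2 : ℝ) < 1 by norm_num)
  rw [one_div, inv_pow, lt_div_iff₀ (by linarith)] at hl
  have h2 : (0:ℝ) < 2 ^ l := by positivity
  obtain ⟨b, hb⟩ := round_dyadic B D h l (fun j => ⌊w j * 2 ^ l⌋₊) (by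
    intro j
    apply Nat.floor_le_of_le
    push_cast
    nlinarith [(hw j).2])
  refine ⟨b, fun i => ?_⟩
  have key : ∑ j, B i j * (w j - (if b j then 1 else 0)) =
      ∑ j, B i j * ((⌊w j * 2 ^ l⌋₊ : ℝ) / 2 ^ l - (if b j then 1 else 0)) +
      ∑ j, B i j * (w j - (⌊w j * 2 ^ l⌋₊ : ℝ) / 2 ^ l) := by
    rw [← Finset.sum_add_distrib]
    exact Finset.sum_congr rfl fun j _ => by ring
  rw [key]
  refine (abs_add_le _ _).trans ?_
  have h3 : |∑ j, B i j * (w j - (⌊w j * 2 ^ l⌋₊ : ℝ) / 2 ^ l)| ≤ C * (2 ^ l)⁻¹ := by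
    refine (Finset.abs_sum_le_sum_abs _ _).trans ?_
    calc _ ≤ ∑ j, |B i j| * (2 ^ l)⁻¹ := by
          refine Finset.sum_le_sum fun j _ => ?_
          rw [abs_mul]
          refine mul_le_mul_of_nonneg_left ?_ (abs_nonneg _)
          have e1 := Nat.floor_le (show 0 ≤ w j * 2 ^ l by have := (hw j).1; positivity)
          have e2 := Nat.lt_floor_add_one (w j * 2 ^ l)
          rw [show w j - (⌊w j * 2 ^ l⌋₊ : ℝ) / 2 ^ l = (w j * 2 ^ l - ⌊w j * 2 ^ l⌋₊) * (2 ^ l)⁻¹ by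
            field_simp]
          rw [abs_mul, abs_of_nonneg (by linarith : 0 ≤ w j * 2 ^ l - ⌊w j * 2 ^ l⌋₊),
            abs_of_nonneg (by positivity)]
          have : (0:ℝ) < (2 ^ l)⁻¹ := by positivity
          nlinarith
      _ = (∑ j, |B i j|) * (2 ^ l)⁻¹ := by rw [Finset.sum_mul]
      _ ≤ _ := by
        refine mul_le_mul_of_nonneg_right ?_ (by positivity)
        exact Finset.single_le_sum (f := fun i => ∑ j, |B i j|) (fun _ _ => by positivity)
          (Finset.mem_univ i)
  have h4 := hb i
  have h5 : (1 - 1 / 2 ^ l) * D ≤ D := by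
    have : 0 ≤ 1 / (2:ℝ) ^ l * D := by positivity
    linarith
  have h6 : (0:ℝ) < (2 ^ l)⁻¹ := by positivity
  nlinarith

open MeasureTheory in
theorem det_bound {κ : Type*} [Fintype κ] [DecidableEq κ] (B : Matrix κ κ ℝ) (D D' : ℝ)
    (hD : 0 ≤ D) (hDD : D < D')
    (h : ∀ Y : Finset κ, ∃ x : κ → ℝ, (∀ j, x j = 1 ∨ x j = -1) ∧
      ∀ i, |∑ j ∈ Y, B i j * x j| ≤ D) : |B.det| ≤ (2 * D') ^ Fintype.card κ := by
  by_cases hdet : B.det = 0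
  · rw [hdet, abs_zero]; have : 0 < D' := by linarith
    positivity
  set Q : Set (κ → ℝ) := Set.Icc (fun _ => -D') (fun _ => D') with hQ
  set P : Set (κ → ℝ) := (toLin' B) ⁻¹' Q with hP
  have hPm : MeasurableSet P := (LinearMap.continuous_of_finiteDimensional _).measurable measurableSet_Icc
  have hvP : volume P = ENNReal.ofReal |B.det⁻¹| * ENNReal.ofReal ((2 * D') ^ Fintype.card κ) := by
    rw [hP, Measure.addHaar_preimage_linearMap]
    · rw [LinearMap.det_toLin', hQ, Real.volume_Icc_pi]
      congr 1
      rw [Finset.prod_const, ENNReal.ofReal_pow (by linarith), Finset.card_univ]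
      congr 2; ring
    · rwa [LinearMap.det_toLin']
  set U : Set (κ → ℝ) := Set.pi Set.univ (fun _ => Set.Ico 0 1) with hU
  have hUm : MeasurableSet U := MeasurableSet.univ_pi fun _ => measurableSet_Ico
  have hvU : volume U = 1 := by
    rw [hU, volume_pi_pi]; simp
  let X : (κ → Bool) → (κ → ℝ) := fun b j => if b j then 1 else 0
  have cover : U ⊆ ⋃ b ∈ (Finset.univ : Finset (κ → Bool)), ((fun w => w + (- X b)) ⁻¹' (P ∩ (fun v => v + X b) ⁻¹' U)) := by
    intro w hw
    obtain ⟨b, hb⟩ := round_real B D D' hD hDD h w (fun j => hw j trivial)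
    simp only [Set.mem_iUnion]
    refine ⟨b, Finset.mem_univ _, ?_, ?_⟩
    · show toLin' B (w + - X b) ∈ Set.Icc _ _
      rw [toLin'_apply]
      have : ∀ i, |(B *ᵥ (w + - X b)) i| ≤ D' := by
        intro i
        have := hb i
        simpa [mulVec, dotProduct, X, sub_eq_add_neg] using this
      exact ⟨fun i => (abs_le.1 (this i)).1, fun i => (abs_le.1 (this i)).2⟩
    · show w + - X b + X b ∈ U
      simpa using hw
  have hdisj : Set.PairwiseDisjoint (↑(Finset.univ : Finset (κ → Bool)))
      (fun b => P ∩ (fun v => v + X b) ⁻¹' U) := by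
    intro b _ b' _ hne
    refine Set.disjoint_left.2 fun v hv hv' => hne ?_
    funext j
    have h1 := hv.2 j trivial
    have h2 := hv'.2 j trivial
    simp only [X, Pi.add_apply, Set.mem_Ico] at h1 h2
    cases hbj : b j <;> cases hbj' : b' j <;> simp [hbj, hbj'] at h1 h2 ⊢ <;> linarith
  have hle : (1 : ENNReal) ≤ volume P := by
    calc (1 : ENNReal) = volume U := hvU.symm
      _ ≤ _ := measure_mono cover
      _ ≤ _ := measure_biUnion_finset_le _ _
      _ = ∑ b : κ → Bool, volume (P ∩ (fun v => v + X b) ⁻¹' U) :=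
          Finset.sum_congr rfl fun b _ => measure_preimage_add_right _ _ _
      _ = volume (⋃ b ∈ (Finset.univ : Finset (κ → Bool)), (P ∩ (fun v => v + X b) ⁻¹' U)) := by
          rw [measure_biUnion_finset hdisj]
          intro b _
          exact hPm.inter ((measurable_add_const _) hUm)
      _ ≤ volume P := measure_mono (by
          simp only [Set.iUnion_subset_iff]
          exact fun _ _ => Set.inter_subset_left)
  rw [hvP, ← ENNReal.ofReal_mul (abs_nonneg _), ENNReal.one_le_ofReal, abs_inv,
    inv_mul_eq_div, le_div_iff₀ (abs_pos.2 hdet), one_mul] at hle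
  exact hle

theorem minors_bound {κ μ ν : Type*} [Fintype κ] [DecidableEq κ] [Fintype ν] [DecidableEq ν]
    [Fintype μ] [DecidableEq μ] (A : Matrix μ ν ℝ) (V : Matrix ν κ ℝ) (hV : Vᵀ * V = 1) (K : ℝ)
    (hK : ∀ (f : κ → μ) (g : κ → ν), |(A.submatrix f g).det| ≤ K) :
    ((Fintype.card κ).factorial : ℝ) ^ 2 * ((A * V)ᵀ * (A * V)).det ≤
      (Fintype.card μ : ℝ) ^ Fintype.card κ * (Fintype.card ν : ℝ) ^ Fintype.card κ * K ^ 2 := by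
  set F : ℝ := ((Fintype.card κ).factorial : ℝ) with hF
  have hF0 : 0 < F := by simp [hF, Nat.factorial_pos]
  have hone : ∑ g : κ → ν, (V.submatrix g id).det ^ 2 = F := by
    have := cb Vᵀ V
    rw [hV, det_one, mul_one] at this
    rw [hF, this]
    refine Finset.sum_congr rfl fun g _ => ?_
    rw [← det_transpose (Vᵀ.submatrix id g), transpose_submatrix, transpose_transpose, sq]
  have h1 : ∀ f : κ → μ, F * ((A * V).submatrix f id).det ^ 2 ≤
      (Fintype.card ν : ℝ) ^ Fintype.card κ * K ^ 2 := by
    intro f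
    have e := cb (A.submatrix f id) V
    have e2 : (A * V).submatrix f id = A.submatrix f id * V := by
      ext i j; simp [mul_apply]
    rw [e2]
    have cs := Finset.sum_mul_sq_le_sq_mul_sq Finset.univ
      (fun g : κ → ν => ((A.submatrix f id).submatrix id g).det)
      (fun g => (V.submatrix g id).det)
    rw [← e, hone] at cs
    have hb : ∑ g : κ → ν, ((A.submatrix f id).submatrix id g).det ^ 2 ≤
        (Fintype.card ν : ℝ) ^ Fintype.card κ * K ^ 2 := by
      calc _ ≤ ∑ g : κ → ν, K ^ 2 := by
            refine Finset.sum_le_sum fun g _ => ?_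
            rw [← sq_abs]
            exact pow_le_pow_left₀ (abs_nonneg _) (hK f g) 2
        _ = _ := by simp
    have : F * (F * (A.submatrix f id * V).det ^ 2) ≤ F * ((Fintype.card ν : ℝ) ^ Fintype.card κ * K ^ 2) := by
      calc _ = (F * (A.submatrix f id * V).det) ^ 2 := by ring
        _ ≤ _ := cs
        _ ≤ _ := by rw [mul_comm]; exact mul_le_mul_of_nonneg_left hb hF0.le
    exact le_of_mul_le_mul_left this hF0
  have e := cb (A * V)ᵀ (A * V)
  calc F ^ 2 * ((A * V)ᵀ * (A * V)).det = F * (F * ((A * V)ᵀ * (A * V)).det) := by ring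
    _ = ∑ f : κ → μ, F * ((A * V).submatrix f id).det ^ 2 := by
      rw [e, Finset.mul_sum]
      refine Finset.sum_congr rfl fun f _ => ?_
      rw [← det_transpose ((A * V)ᵀ.submatrix id f), transpose_submatrix, transpose_transpose, sq]
    _ ≤ ∑ f : κ → μ, (Fintype.card ν : ℝ) ^ Fintype.card κ * K ^ 2 :=
      Finset.sum_le_sum fun f _ => h1 f
    _ = _ := by simp; ring

/-- every minor is bounded by the hereditary discrepancy -/
theorem minor_le {κ : Type*} [Fintype κ] [DecidableEq κ] {m n : ℕ}
    (A : Matrix (Fin m) (Fin n) ℝ) (D D' : ℝ) (hD : 0 ≤ D) (hDD : D < D')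
    (h : ∀ Y : Finset (Fin n), ∃ x : Fin n → ℝ, (∀ j, x j = 1 ∨ x j = -1) ∧
      ∀ i, |∑ j ∈ Y, A i j * x j| ≤ D) (f : κ → Fin m) (g : κ → Fin n) :
    |(A.submatrix f g).det| ≤ (2 * D') ^ Fintype.card κ := by
  by_cases hg : Function.Injective g
  · refine det_bound _ D D' hD hDD fun Y => ?_
    obtain ⟨x, hx, hx'⟩ := h (Y.image g)
    refine ⟨x ∘ g, fun j => hx _, fun i => ?_⟩
    have := hx' (f i)
    rw [Finset.sum_image (fun a _ b _ hab => hg hab)] at this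
    simpa using this
  · have : ∃ a b, g a = g b ∧ a ≠ b := by
      simpa [Function.Injective] using hg
    obtain ⟨a, b, hab, hne⟩ := this
    rw [det_zero_of_column_eq hne (fun i => by simp [hab]), abs_zero]
    have : 0 < D' := by linarith
    positivity

/-- many large eigenvalues -/
theorem eig_part {m n : ℕ} (hm : 0 < m) (hn : 0 < n) (A : Matrix (Fin m) (Fin n) ℝ)
    (hM0 : Aᵀ * A ≠ 0) :
    0 < (Aᵀ * A).trace ∧ 0 < ((Aᵀ * A) * (Aᵀ * A)).trace ∧
    ∃ (κ : Type) (_ : Fintype κ) (_ : DecidableEq κ) (V : Matrix (Fin n) κ ℝ),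
      Vᵀ * V = 1 ∧
      ((Aᵀ * A).trace / (4 * (min m n : ℕ))) ^ Fintype.card κ ≤ ((A * V)ᵀ * (A * V)).det ∧
      9 / 16 * (Aᵀ * A).trace ^ 2 ≤ Fintype.card κ * ((Aᵀ * A) * (Aᵀ * A)).trace := by
  classical
  set M := Aᵀ * A with hMdef
  have hps : M.PosSemidef := by
    have := posSemidef_conjTranspose_mul_self A
    rwa [conjTranspose_eq_transpose_of_trivial] at this
  have hM : M.IsHermitian := hps.isHermitian
  set lam := hM.eigenvalues with hlam
  have hlam0 : ∀ i, 0 ≤ lam i := hps.eigenvalues_nonneg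
  set U : Matrix (Fin n) (Fin n) ℝ := (hM.eigenvectorUnitary).1 with hU
  have hUU : Uᵀ * U = 1 := by
    have := Unitary.coe_star_mul_self hM.eigenvectorUnitary
    rwa [star_eq_conjTranspose, conjTranspose_eq_transpose_of_trivial] at this
  have hUU' : U * Uᵀ = 1 := mul_eq_one_comm.1 hUU
  have hdiag : Uᵀ * M * U = diagonal lam := by
    have := hM.conjStarAlgAut_star_eigenvectorUnitary
    rw [Unitary.conjStarAlgAut_star_apply, star_eq_conjTranspose,
      conjTranspose_eq_transpose_of_trivial] at this
    exact this
  have htr : M.trace = ∑ i, lam i := by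
    have := congrArg trace hdiag
    rw [mul_assoc, trace_mul_comm, mul_assoc, hUU', mul_one, trace_diagonal] at this
    exact this
  have htr2 : (M * M).trace = ∑ i, lam i ^ 2 := by
    have h2 : (Uᵀ * M * U) * (Uᵀ * M * U) = Uᵀ * (M * M) * U := by
      calc _ = Uᵀ * M * (U * Uᵀ) * M * U := by simp only [mul_assoc]
        _ = _ := by rw [hUU']; simp only [mul_assoc, mul_one]
    have := congrArg trace h2
    rw [hdiag, diagonal_mul_diagonal, trace_diagonal, mul_assoc, trace_mul_comm Uᵀ, mul_assoc, hUU', mul_one] at this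
    rw [← this]
    exact Finset.sum_congr rfl fun i _ => (sq _).symm
  have hex : ∃ i, 0 < lam i := by
    by_contra hcon
    push Not at hcon
    have : lam = 0 := funext fun i => le_antisymm (hcon i) (hlam0 i)
    exact hM0 (hM.eigenvalues_eq_zero_iff.1 this)
  obtain ⟨i0, hi0⟩ := hex
  have ht : 0 < M.trace := by
    rw [htr]
    exact Finset.sum_pos' (fun i _ => hlam0 i) ⟨i0, Finset.mem_univ _, hi0⟩
  have hs : 0 < (M * M).trace := by
    rw [htr2]
    exact Finset.sum_pos' (fun i _ => sq_nonneg _) ⟨i0, Finset.mem_univ _, by positivity⟩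
  set L : ℝ := M.trace / (4 * (min m n : ℕ)) with hL
  have hmin : (0:ℝ) < (min m n : ℕ) := by exact_mod_cast lt_min hm hn
  have hL0 : 0 < L := by positivity
  refine ⟨ht, hs, {i // L ≤ lam i}, inferInstance, inferInstance, U.submatrix id Subtype.val, ?_, ?_, ?_⟩
  · have : (U.submatrix id (Subtype.val : {i // L ≤ lam i} → Fin n))ᵀ * U.submatrix id (Subtype.val : {i // L ≤ lam i} → Fin n)
        = (Uᵀ * U).submatrix (Subtype.val : {i // L ≤ lam i} → Fin n) (Subtype.val : {i // L ≤ lam i} → Fin n) := by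
      ext i j; simp [mul_apply]
    rw [this, hUU, submatrix_one _ Subtype.val_injective]
  · have : (A * U.submatrix id (Subtype.val : {i // L ≤ lam i} → Fin n))ᵀ *
        (A * U.submatrix id (Subtype.val : {i // L ≤ lam i} → Fin n))
        = (Uᵀ * M * U).submatrix (Subtype.val : {i // L ≤ lam i} → Fin n) (Subtype.val : {i // L ≤ lam i} → Fin n) := by
      have e : A * U.submatrix id (Subtype.val : {i // L ≤ lam i} → Fin n)
          = (A * U).submatrix id Subtype.val := by
        ext i j; simp [mul_apply]
      have e' : Uᵀ * M * U = (A * U)ᵀ * (A * U) := by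
        rw [transpose_mul, hMdef]; simp only [Matrix.mul_assoc]
      rw [e, e']
      ext i j; simp [mul_apply]
    rw [this, hdiag, submatrix_diagonal _ _ Subtype.val_injective, det_diagonal]
    rw [← Finset.card_univ, ← Finset.prod_const]
    exact Finset.prod_le_prod (fun _ _ => hL0.le) fun i _ => i.2
  · have hcard : Fintype.card {i // L ≤ lam i} = (Finset.univ.filter fun i => L ≤ lam i).card :=
      Fintype.card_subtype _
    have hrank : ((Finset.univ.filter fun i => lam i ≠ 0).card) ≤ min m n := by
      have h1 := hM.rank_eq_card_non_zero_eigs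
      rw [Fintype.card_subtype] at h1
      rw [← h1, hMdef, rank_transpose_mul_self]
      exact le_min (by simpa using rank_le_card_height A) (by simpa using rank_le_card_width A)
    have hsmall : ∑ i ∈ Finset.univ.filter (fun i => ¬ L ≤ lam i), lam i ≤ M.trace / 4 := by
      calc _ ≤ ∑ i ∈ Finset.univ.filter (fun i => lam i ≠ 0), L := by
            rw [Finset.sum_filter, Finset.sum_filter]
            refine Finset.sum_le_sum fun i _ => ?_
            by_cases h0 : lam i = 0
            · simp [h0]
            · rw [if_pos h0]
              split_ifs <;> linarith
        _ = ((Finset.univ.filter fun i => lam i ≠ 0).card : ℝ) * L := by simp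
        _ ≤ ((min m n : ℕ) : ℝ) * L :=
            mul_le_mul_of_nonneg_right (by exact_mod_cast hrank) hL0.le
        _ = _ := by rw [hL]; field_simp
    have hsplit := Finset.sum_filter_add_sum_filter_not Finset.univ (fun i => L ≤ lam i) lam
    rw [← htr] at hsplit
    have hbig : 3 / 4 * M.trace ≤ ∑ i ∈ Finset.univ.filter (fun i => L ≤ lam i), lam i := by
      linarith
    have cs := sq_sum_le_card_mul_sum_sq (s := Finset.univ.filter (fun i => L ≤ lam i)) (f := lam)
    have hsq : ∑ i ∈ Finset.univ.filter (fun i => L ≤ lam i), lam i ^ 2 ≤ (M * M).trace := by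
      rw [htr2]
      exact Finset.sum_le_sum_of_subset_of_nonneg (Finset.filter_subset _ _)
        fun _ _ _ => sq_nonneg _
    rw [hcard]
    calc 9 / 16 * M.trace ^ 2 = (3 / 4 * M.trace) ^ 2 := by ring
      _ ≤ _ := pow_le_pow_left₀ (by positivity) hbig 2
      _ ≤ _ := cs
      _ ≤ _ := mul_le_mul_of_nonneg_left hsq (by positivity)

/-- Larsen's trace lower bound on hereditary discrepancy: for a 0/1 matrix
A with M = AᵀA ≠ 0, there is a set Y of columns on which every ±1 coloring
has discrepancy at least
(tr M)²/(8e·tr(M²)·min{m,n}) · √(tr M / max{m,n}). -/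
theorem stmt11 (m n : ℕ) (hm : 0 < m) (hn : 0 < n)
    (A : Matrix (Fin m) (Fin n) ℝ)
    (hA : ∀ i j, A i j = 0 ∨ A i j = 1) (hM0 : Aᵀ * A ≠ 0) :
    ∃ Y : Finset (Fin n), ∀ x : Fin n → ℝ, (∀ j, x j = 1 ∨ x j = -1) →
      ∃ i, (Aᵀ * A).trace ^ 2 /
            (8 * Real.exp 1 * ((Aᵀ * A) * (Aᵀ * A)).trace * (min m n : ℕ)) *
          Real.sqrt ((Aᵀ * A).trace / (max m n : ℕ)) ≤
        |∑ j ∈ Y, A i j * x j| := by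
  by_contra hcon
  push Not at hcon
  obtain ⟨ht, hs, κ, _, _, V, hV, hdet, hk⟩ := eig_part hm hn A hM0
  set t := (Aᵀ * A).trace with htdef
  set s := ((Aᵀ * A) * (Aᵀ * A)).trace with hsdef
  set k := Fintype.card κ with hkdef
  have hmn : ((min m n : ℕ) : ℝ) * (max m n : ℕ) = m * n := by
    rw [← Nat.cast_mul, min_mul_max, Nat.cast_mul]
  set a : ℝ := ((min m n : ℕ) : ℝ) with ha
  set b : ℝ := ((max m n : ℕ) : ℝ) with hb
  have ha0 : 0 < a := by rw [ha]; exact_mod_cast lt_min hm hn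
  have hb0 : 0 < b := by rw [hb]; exact_mod_cast lt_max_of_lt_left hm
  set e := Real.exp 1 with he
  have he0 : 0 < e := Real.exp_pos 1
  set D : ℝ := t ^ 2 / (8 * e * s * a) * Real.sqrt (t / b) with hD
  have hD0 : 0 < D := by positivity
  have hDsq : D ^ 2 = t ^ 5 / (64 * e ^ 2 * s ^ 2 * a ^ 2 * b) := by
    rw [hD, mul_pow, Real.sq_sqrt (by positivity)]
    field_simp; norm_num
  have hmin := minors_bound A V hV ((2 * (17 / 16 * D)) ^ k) (fun f g =>
    minor_le A D (17 / 16 * D) hD0.le (by linarith) (fun Y => by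
      obtain ⟨x, hx, hx'⟩ := hcon Y
      exact ⟨x, hx, fun i => (hx' i).le⟩) f g)
  simp only [Fintype.card_fin] at hmin
  have hk0 : 0 < (k : ℝ) := by
    by_contra h0
    have : 0 < 9 / 16 * t ^ 2 := by positivity
    nlinarith
  have hkn : k ≠ 0 := by intro h; simp [h] at hk0
  have hfac : ((k : ℝ) / e) ^ k ≤ (k.factorial : ℝ) := by
    have h1 := Real.pow_div_factorial_le_exp (x := (k : ℝ)) (by positivity) k
    have h2 : Real.exp k = e ^ k := by rw [he, ← Real.exp_nat_mul, mul_one]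
    have hf : (0:ℝ) < k.factorial := by exact_mod_cast Nat.factorial_pos k
    rw [h2, div_le_iff₀ hf] at h1
    rw [div_pow, div_le_iff₀ (by positivity)]
    linarith
  have hfin : (((k : ℝ) / e) ^ 2 * (t / (4 * a))) ^ k ≤ (a * b * (2 * (17 / 16 * D)) ^ 2) ^ k := by
    calc _ = (((k : ℝ) / e) ^ k) ^ 2 * (t / (4 * a)) ^ k := by rw [mul_pow]; ring
      _ ≤ (k.factorial : ℝ) ^ 2 * ((A * V)ᵀ * (A * V)).det := by
        refine mul_le_mul (pow_le_pow_left₀ (by positivity) hfac 2) hdet (by positivity)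
          (by positivity)
      _ ≤ _ := hmin
      _ = _ := by rw [hmn, mul_pow (_ * _), mul_pow (m : ℝ), ← hkdef, ← pow_mul, ← pow_mul, mul_comm k 2]
  have hfin2 := le_of_pow_le_pow_left₀ hkn (by positivity) hfin
  have hk2 : (9 / 16 * t ^ 2) ^ 2 ≤ (k * s) ^ 2 := pow_le_pow_left₀ (by positivity) hk 2
  have e1 : (2 * (17 / 16 * D)) ^ 2 = 289 / 64 * D ^ 2 := by ring
  rw [e1, hDsq] at hfin2
  have e2 : a * b * (289 / 64 * (t ^ 5 / (64 * e ^ 2 * s ^ 2 * a ^ 2 * b))) =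
      (289 / 4096 * t ^ 4) * (t / (e ^ 2 * s ^ 2 * a)) := by field_simp; norm_num
  have e3 : ((k : ℝ) / e) ^ 2 * (t / (4 * a)) = ((k * s) ^ 2 / 4) * (t / (e ^ 2 * s ^ 2 * a)) := by
    field_simp
  rw [e2, e3] at hfin2
  have hfin3 := le_of_mul_le_mul_right hfin2 (by positivity)
  have : 0 < t ^ 4 := by positivity
  nlinarith
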